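/- The polynomial Π(σ) = Σ_{0 ≤ i ≤ p−2, v_{-i} even} σ^i annihilates the non-p-part of the ideal class group of K: for every ideal class c of O_K whose order is coprime to p, one has ∏_{0 ≤ i ≤ p−2, v_{-i} even} σ^i(c) = 1. -/

import Mathlib

open NumberField Finset nonZeroDivisors

theorem aux_gen {K : Type*} [Field K] [NumberField K] (z : K) (hz : IntermediateField.adjoin ℚ {z} = ⊤)
    (a : K) (n : ℕ) (hn : n ≠ 0) :
    ∃ k : ℕ, IntermediateField.adjoin ℚ {a + n * k * z} = ⊤ := by
  have hf : Finite (IntermediateField ℚ K) := Field.finite_intermediateField_of_exists_primitive_element ℚ K ⟨z, hz⟩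
  obtain ⟨k, k', hne, h⟩ := Finite.exists_ne_map_eq_of_infinite
    (fun k : ℕ => IntermediateField.adjoin ℚ {a + n * k * z})
  refine ⟨k, ?_⟩
  rw [eq_top_iff, ← hz, IntermediateField.adjoin_simple_le_iff]
  set L := IntermediateField.adjoin ℚ {a + n * k * z} with hL
  have h1 : a + n * k * z ∈ L := IntermediateField.mem_adjoin_simple_self ℚ _
  have h2 : a + n * k' * z ∈ L := h ▸ IntermediateField.mem_adjoin_simple_self ℚ _
  have h3 := L.sub_mem h1 h2
  have h4 : (n : K) * (k - k') ∈ L :=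
    L.mul_mem (natCast_mem L n) (L.sub_mem (natCast_mem L k) (natCast_mem L k'))
  have h5 : (n : K) * (k - k') ≠ 0 := by
    refine mul_ne_zero (by exact_mod_cast hn) (sub_ne_zero.2 (by exact_mod_cast hne))
  have h6 : z = ((n : K) * (k - k'))⁻¹ * (a + n * k * z - (a + n * k' * z)) := by
    have e : a + n * k * z - (a + n * k' * z) = ((n : K) * (k - k')) * z := by ring
    rw [e, inv_mul_cancel_left₀ h5]
  rw [h6]
  exact L.mul_mem (L.inv_mem h4) h3

theorem aux_poly {K : Type*} [Field K] [NumberField K] (z a : 𝓞 K)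
    (ha : IntermediateField.adjoin ℚ {(a : K)} = ⊤) :
    ∃ (m : ℕ) (f : Polynomial ℤ), m ≠ 0 ∧ (m : 𝓞 K) * z = Polynomial.aeval a f := by
  have h1 : (z : K) ∈ IntermediateField.adjoin ℚ {(a : K)} := ha ▸ IntermediateField.mem_top
  rw [← IntermediateField.mem_toSubalgebra, IntermediateField.adjoin_simple_toSubalgebra_of_isAlgebraic
    (Algebra.IsAlgebraic.isAlgebraic _), Algebra.adjoin_singleton_eq_range_aeval] at h1
  obtain ⟨q, hq⟩ := h1
  obtain ⟨b, hb, hb'⟩ := IsLocalization.integerNormalization_spec (nonZeroDivisors ℤ) q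
  set f := IsLocalization.integerNormalization (nonZeroDivisors ℤ) q
  have hq' : Polynomial.aeval (a : K) q = z := hq
  have key : (b : ℤ) * (z : K) = Polynomial.aeval (a : K) f := by
    rw [← hq', ← Polynomial.aeval_map_algebraMap ℚ (a : K) f, hb']
    simp
  have key2 : ((b : ℤ) : 𝓞 K) * z = Polynomial.aeval a f := by
    apply NumberField.RingOfIntegers.coe_injective
    have : algebraMap (𝓞 K) K (Polynomial.aeval a f) = Polynomial.aeval (a : K) f :=
      (Polynomial.aeval_algebraMap_apply K a f).symm
    rw [this, ← key]; simp
  have hb0 : b ≠ 0 := nonZeroDivisors.ne_zero hb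
  refine ⟨b.natAbs, Polynomial.C (b.sign) * f, by simpa using hb0, ?_⟩
  have h2 : ((b.natAbs : ℤ)) = b.sign * b := (Int.sign_mul_self_eq_abs b ▸ (Int.natCast_natAbs b))
  have h3 : ((b.natAbs : ℕ) : 𝓞 K) = ((b.sign * b : ℤ) : 𝓞 K) := by rw [← h2]; simp
  rw [h3, map_mul, ← key2]
  rw [Polynomial.aeval_C, Int.cast_mul]
  simp only [algebraMap_int_eq, eq_intCast, mul_assoc]

theorem aux_deg1 {K : Type*} [Field K] [NumberField K] (z : 𝓞 K)
    (hz : IntermediateField.adjoin ℚ {(z : K)} = ⊤)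
    (hz' : (z : K) ∉ (⊥ : IntermediateField ℚ K)) (m0 : ℕ) (hm0 : m0 ≠ 0)
    (c : ClassGroup (𝓞 K)) :
    ∃ X : (Ideal (𝓞 K))⁰, c = (ClassGroup.mk0 X)⁻¹ ∧
      ∀ P : Ideal (𝓞 K), P.IsPrime → (X : Ideal (𝓞 K)) ≤ P →
        ∃ l : ℕ, l.Prime ∧ (l : 𝓞 K) ∈ P ∧ ¬ l ∣ m0 ∧ ∃ t : ℤ, z - (t : 𝓞 K) ∈ P := by
  obtain ⟨⟨J, hJm⟩, rfl⟩ := ClassGroup.mk0_surjective c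
  have hJ0 : J ≠ 0 := nonZeroDivisors.ne_zero hJm
  set n := Ideal.absNorm J with hn
  have hn0 : n ≠ 0 := by rw [hn, Ne, Ideal.absNorm_eq_zero_iff]; exact hJ0
  have hnJ : (n : 𝓞 K) ∈ J := Ideal.absNorm_mem _
  have hnK : (n : 𝓞 K) ≠ 0 := by exact_mod_cast hn0
  set N : Ideal (𝓞 K) := Ideal.span {(n : 𝓞 K)} with hN
  have hN0 : N ≠ 0 := by simpa [hN] using hnK
  obtain ⟨a, ha⟩ := IsDedekindDomain.exists_sup_span_eq (I := N * J) (J := J) Ideal.mul_le_right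
    (mul_ne_zero hN0 hJ0)
  obtain ⟨k, hk⟩ := aux_gen (z : K) hz (a : K) (n ^ 2) (by positivity)
  set a' : 𝓞 K := a + n ^ 2 * k * z with ha'
  have hnN : (n : 𝓞 K) ∈ N := Ideal.mem_span_singleton_self _
  have hn2 : ∀ y : 𝓞 K, (n : 𝓞 K) ^ 2 * y ∈ N * J := fun y => by
    rw [pow_two]
    exact Ideal.mul_mem_right _ _ (Ideal.mul_mem_mul hnN hnJ)
  have hk' : IntermediateField.adjoin ℚ {(a' : K)} = ⊤ := by
    rw [← hk]; congr; simp [ha']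
  obtain ⟨m, f, hm, hf⟩ := aux_poly z a' hk'
  set m' := ∏ q ∈ (m * m0).primeFactors \ n.primeFactors, q with hm'
  have hcop : Nat.Coprime m' n := by
    refine Nat.Coprime.prod_left fun q hq => ?_
    rw [Finset.mem_sdiff, Nat.mem_primeFactors, Nat.mem_primeFactors] at hq
    rw [hq.1.1.coprime_iff_not_dvd]
    exact fun h => hq.2 ⟨hq.1.1, h, hn0⟩
  have hm'0 : m' ≠ 0 := by
    refine Finset.prod_ne_zero_iff.2 fun q hq => ?_
    rw [Finset.mem_sdiff, Nat.mem_primeFactors] at hq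
    exact hq.1.1.ne_zero
  set x : 𝓞 K := n ^ 2 + m' * a' with hx
  have haJ : a ∈ J := by
    rw [← ha]; exact Ideal.mem_sup_right (Ideal.mem_span_singleton_self _)
  have hNJ : N * J ≤ J := Ideal.mul_le_right
  have ha'J : a' ∈ J := add_mem haJ (by rw [mul_assoc]; exact hNJ (hn2 _))
  have hxJ : x ∈ J :=
    add_mem (by simpa using hNJ (hn2 1)) (Ideal.mul_mem_left _ _ ha'J)
  have hx0 : x ≠ 0 := by
    intro h0
    apply hz'
    have : (a' : K) ∈ (⊥ : IntermediateField ℚ K) := by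
      have h1 : (n : K) ^ 2 + m' * a' = 0 := by
        have := congrArg (algebraMap (𝓞 K) K) h0
        simpa [hx] using this
      have h2 : (a' : K) = - (n : K) ^ 2 * (m' : K)⁻¹ := by
        have : (m' : K) ≠ 0 := by exact_mod_cast hm'0
        field_simp
        linear_combination h1
      rw [h2]
      exact mul_mem (neg_mem (pow_mem (natCast_mem _ _) _)) (inv_mem (natCast_mem _ _))
    have h3 := IntermediateField.adjoin_simple_le_iff.2 this
    rw [hk'] at h3
    exact h3 IntermediateField.mem_top
  obtain ⟨X, hX⟩ : J ∣ Ideal.span {x} := by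
    rw [Ideal.dvd_iff_le, Ideal.span_singleton_le_iff_mem]; exact hxJ
  have hX0 : X ≠ 0 := by
    rintro rfl
    rw [mul_zero] at hX
    exact hx0 (by simpa using hX)
  have hsup : N * J ⊔ Ideal.span {x} = J := by
    apply le_antisymm
    · exact sup_le hNJ (by rwa [Ideal.span_singleton_le_iff_mem])
    · conv_lhs => rw [← ha]
      refine sup_le le_sup_left ?_
      rw [Ideal.span_singleton_le_iff_mem]
      obtain ⟨u, w, huw⟩ : IsCoprime (m' : ℤ) (n : ℤ) := Nat.isCoprime_iff_coprime.2 hcop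
      have huw' : (u : 𝓞 K) * m' + w * n = 1 := by exact_mod_cast congrArg (Int.cast : ℤ → 𝓞 K) huw
      have e : a = (n * (w * a) + n ^ 2 * (- u - u * m' * (k * z))) + u * x := by
        rw [hx, ha']
        linear_combination (-a) * huw'
      rw [e]
      refine add_mem (Ideal.mem_sup_left (add_mem ?_ (hn2 _))) (Ideal.mem_sup_right ?_)
      · exact Ideal.mul_mem_mul hnN (Ideal.mul_mem_left _ _ haJ)
      · exact Ideal.mul_mem_left _ _ (Ideal.mem_span_singleton_self _)
  have hNX : N ⊔ X = ⊤ := by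
    rw [hX, mul_comm N, ← Ideal.mul_sup] at hsup
    rw [← Ideal.one_eq_top]
    exact mul_left_cancel₀ hJ0 (by rw [hsup, mul_one])
  refine ⟨⟨X, mem_nonZeroDivisors_of_ne_zero hX0⟩, ?_, ?_⟩
  · rw [eq_inv_iff_mul_eq_one, ← map_mul, ClassGroup.mk0_eq_one_iff]
    refine ⟨⟨x, ?_⟩⟩
    simp only [Submonoid.coe_mul]
    rw [← hX]
  · intro P hP hXP
    have hXP : X ≤ P := hXP
    have hnP : (n : 𝓞 K) ∉ P := fun h => by
      apply hP.ne_top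
      rw [eq_top_iff, ← hNX]
      exact sup_le (by rwa [hN, Ideal.span_singleton_le_iff_mem]) hXP
    have hPb : P ≠ ⊥ := fun h => hX0 (by rw [h] at hXP; exact le_bot_iff.1 hXP)
    have hxP : x ∈ P := by
      apply hXP
      apply (Ideal.mul_le_right : J * X ≤ X)
      rw [← hX]
      exact Ideal.mem_span_singleton_self _
    have hex : ∃ l : ℕ, l.Prime ∧ (l : 𝓞 K) ∈ P := by
      have h1 : ((Ideal.absNorm P : ℕ) : 𝓞 K) ∈ P := Ideal.absNorm_mem _
      have h2 : Ideal.absNorm P ≠ 0 := by rwa [Ne, Ideal.absNorm_eq_zero_iff]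
      rw [← Nat.prod_primeFactorsList h2, Nat.cast_list_prod, ← Multiset.prod_coe] at h1
      obtain ⟨y, hy, hyP⟩ := (Ideal.IsPrime.multiset_prod_mem_iff_exists_mem hP _).1 h1
      rw [Multiset.mem_coe, List.mem_map] at hy
      obtain ⟨l, hl, rfl⟩ := hy
      exact ⟨l, Nat.prime_of_mem_primeFactorsList hl, hyP⟩
    obtain ⟨l, hl, hlP⟩ := hex
    have hdvd : ∀ r : ℕ, l ∣ r → (r : 𝓞 K) ∈ P := by
      rintro r ⟨s, rfl⟩
      push_cast
      exact Ideal.mul_mem_right _ _ hlP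
    have hln : ¬ l ∣ n := fun h => hnP (hdvd n h)
    have hinv : ∀ r : ℕ, ¬ l ∣ r → ∃ u : ℤ, (u : 𝓞 K) * r - 1 ∈ P := by
      intro r hr
      obtain ⟨u, w, huw⟩ : IsCoprime (r : ℤ) (l : ℤ) :=
        Nat.isCoprime_iff_coprime.2 ((Nat.coprime_comm.1 ((hl.coprime_iff_not_dvd).2 hr)))
      have huw' : (u : 𝓞 K) * r + w * l = 1 := by exact_mod_cast congrArg (Int.cast : ℤ → 𝓞 K) huw
      refine ⟨u, ?_⟩
      have : (u : 𝓞 K) * r - 1 = (-w) * l := by linear_combination huw'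
      rw [this]
      exact Ideal.mul_mem_left _ _ hlP
    have hlm' : ¬ l ∣ m' := by
      intro h
      have h1 : (n : 𝓞 K) ^ 2 ∈ P := by
        have : (n : 𝓞 K) ^ 2 = x - m' * a' := by rw [hx]; ring
        rw [this]
        exact sub_mem hxP (Ideal.mul_mem_right _ _ (hdvd _ h))
      exact hnP (hP.mem_of_pow_mem _ h1)
    have hlM : ¬ l ∣ m * m0 := by
      intro h
      apply hlm'
      apply Finset.dvd_prod_of_mem
      rw [Finset.mem_sdiff, Nat.mem_primeFactors, Nat.mem_primeFactors]
      exact ⟨⟨hl, h, mul_ne_zero hm hm0⟩, fun h' => hln h'.2.1⟩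
    refine ⟨l, hl, hlP, fun h => hlM (h.mul_left _), ?_⟩
    obtain ⟨u, hu⟩ := hinv m' hlm'
    obtain ⟨w, hw⟩ := hinv m (fun h => hlM (h.mul_right _))
    have h1 : a' - ((-u * n ^ 2 : ℤ) : 𝓞 K) ∈ P := by
      have : a' - ((-u * n ^ 2 : ℤ) : 𝓞 K) = u * x - (u * m' - 1) * a' := by
        rw [hx]; push_cast; ring
      rw [this]
      exact sub_mem (Ideal.mul_mem_left _ _ hxP) (Ideal.mul_mem_right _ _ hu)
    set t0 : ℤ := -u * n ^ 2
    have h2 : Polynomial.aeval a' f - ((f.eval t0 : ℤ) : 𝓞 K) ∈ P := by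
      have h3 := Polynomial.sub_dvd_eval_sub a' (t0 : 𝓞 K) (f.map (Int.castRingHom (𝓞 K)))
      have h4 := Ideal.mem_of_dvd P h3 h1
      have e1 : (f.map (Int.castRingHom (𝓞 K))).eval a' = Polynomial.aeval a' f := by
        rw [Polynomial.eval_map, Polynomial.aeval_def]; rfl
      have e2 : (f.map (Int.castRingHom (𝓞 K))).eval (t0 : 𝓞 K) = ((f.eval t0 : ℤ) : 𝓞 K) := by
        simp
      rwa [e1, e2] at h4
    refine ⟨w * f.eval t0, ?_⟩
    have : z - ((w * f.eval t0 : ℤ) : 𝓞 K) =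
      w * (Polynomial.aeval a' f - ((f.eval t0 : ℤ) : 𝓞 K)) - (w * m - 1) * z := by
      rw [← hf]; push_cast; ring
    rw [this]
    exact sub_mem (Ideal.mul_mem_left _ _ h2) (Ideal.mul_mem_right _ _ hw)


theorem aux_hom {R : Type*} [CommRing R] (z : R) (hz : Algebra.adjoin ℤ {z} = ⊤)
    (P : Ideal R) (hP : P.IsPrime) (l : ℕ) (hl : l.Prime) (hlP : (l : R) ∈ P)
    (t : ℤ) (ht : z - (t : R) ∈ P) :
    ∃ φ : R →+* ZMod l, RingHom.ker φ = P := by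
  have hfac : Fact l.Prime := ⟨hl⟩
  have hmem : ∀ r : R, ∃ s : ℤ, r - (s : R) ∈ P := by
    intro r
    have hr : r ∈ Algebra.adjoin ℤ {z} := hz ▸ Algebra.mem_top
    induction hr using Algebra.adjoin_induction with
    | mem x hx => exact ⟨t, by rw [Set.mem_singleton_iff.1 hx]; exact ht⟩
    | algebraMap s => exact ⟨s, by simp⟩
    | add x y _ _ h1 h2 =>
      obtain ⟨a, ha⟩ := h1
      obtain ⟨b, hb⟩ := h2
      refine ⟨a + b, ?_⟩
      have : x + y - ((a + b : ℤ) : R) = (x - a) + (y - b) := by push_cast; ring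
      rw [this]; exact add_mem ha hb
    | mul x y _ _ h1 h2 =>
      obtain ⟨a, ha⟩ := h1
      obtain ⟨b, hb⟩ := h2
      refine ⟨a * b, ?_⟩
      have : x * y - ((a * b : ℤ) : R) = (x - a) * y + a * (y - b) := by push_cast; ring
      rw [this]; exact add_mem (Ideal.mul_mem_right _ _ ha) (Ideal.mul_mem_left _ _ hb)
  have hchar : CharP (R ⧸ P) l := by
    have h0 : (l : R ⧸ P) = 0 := by
      have := Ideal.Quotient.eq_zero_iff_mem.2 hlP
      simpa using this
    exact ringChar.of_eq (CharP.ringChar_of_prime_eq_zero hl h0)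
  let f : ZMod l →+* R ⧸ P := ZMod.castHom (dvd_refl l) (R ⧸ P)
  have hf : Function.Bijective f := by
    refine ⟨f.injective, fun y => ?_⟩
    obtain ⟨r, rfl⟩ := Ideal.Quotient.mk_surjective y
    obtain ⟨s, hs⟩ := hmem r
    refine ⟨s, ?_⟩
    rw [map_intCast]
    have := (Ideal.Quotient.eq.2 hs)
    rw [this]; simp
  let e := RingEquiv.ofBijective f hf
  refine ⟨(e.symm : R ⧸ P →+* ZMod l).comp (Ideal.Quotient.mk P), ?_⟩
  ext x
  simp [RingHom.mem_ker, Ideal.Quotient.eq_zero_iff_mem]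

theorem aux_prim {R : Type*} [CommRing R] [IsDomain R] (p : ℕ) (hp : p.Prime) (z : R)
    (hz : IsPrimitiveRoot z p) (l : ℕ) (hl : l.Prime) (hlp : ¬ l ∣ p) (φ : R →+* ZMod l) :
    IsPrimitiveRoot (φ z) p := by
  have hfac : Fact l.Prime := ⟨hl⟩
  have h1 : (φ z) ^ p = 1 := by rw [← map_pow, hz.pow_eq_one, map_one]
  have h2 : φ z ≠ 1 := by
    intro h
    have h3 := hz.geom_sum_eq_zero hp.one_lt
    have h4 := congrArg φ h3
    rw [map_sum] at h4
    simp [h] at h4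
    exact hlp ((ZMod.natCast_eq_zero_iff _ _).1 h4)
  have hfp : Fact p.Prime := ⟨hp⟩
  have := IsPrimitiveRoot.orderOf (φ z)
  rwa [orderOf_eq_prime h1 h2] at this

theorem aux_char {R : Type*} [CommRing R] [IsDomain R] (p : ℕ) (hp : p.Prime) (z : R)
    (hz : IsPrimitiveRoot z p) (l : ℕ) [Fact l.Prime] (φ : R →+* ZMod l)
    (hφ : IsPrimitiveRoot (φ z) p) :
    ∃ (χ : MulChar (ZMod l) R) (k : ℕ), p * k = l - 1 ∧ k ≠ 0 ∧
      (∀ x, φ (χ x) = x ^ k) ∧ χ ^ p = 1 ∧ (∀ a : ℕ, χ ^ a = 1 → p ∣ a) ∧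
      (∀ x, x ≠ 0 → ∃ j : ℕ, χ x = z ^ j) := by
  have hl : l.Prime := Fact.out
  have hφ0 : φ z ≠ 0 := hφ.ne_zero hp.ne_zero
  obtain ⟨k, hk⟩ : p ∣ l - 1 := by
    rw [hφ.eq_orderOf]
    exact ZMod.orderOf_dvd_card_sub_one hφ0
  have hk0 : k ≠ 0 := by
    rintro rfl
    have := hl.one_lt
    omega
  obtain ⟨g, hg⟩ := IsCyclic.exists_generator (α := (ZMod l)ˣ)
  have hgl : orderOf g = l - 1 := by
    rw [orderOf_eq_card_of_forall_mem_zpowers hg, Nat.card_eq_fintype_card, ZMod.card_units_eq_totient,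
      Nat.totient_prime hl]
  have hgk : ((g : ZMod l) ^ k) ^ p = 1 := by
    rw [← pow_mul, mul_comm, ← hk, ← Units.val_pow_eq_pow_val, ← hgl, pow_orderOf_eq_one, Units.val_one]
  have : NeZero p := ⟨hp.ne_zero⟩
  obtain ⟨j, hj, hjk⟩ := hφ.eq_pow_of_pow_eq_one hgk
  let u : Rˣ := (hz.isUnit hp.ne_zero).unit ^ j
  have hu : (u : R) = z ^ j := by simp [u]
  have hup : u ^ p = 1 := by
    ext; rw [Units.val_pow_eq_pow_val, hu, ← pow_mul, mul_comm, pow_mul, hz.pow_eq_one]; simp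
  have humem : u ∈ rootsOfUnity (Fintype.card (ZMod l)ˣ) R := by
    rw [mem_rootsOfUnity, ZMod.card_units_eq_totient, Nat.totient_prime hl, hk, pow_mul, hup, one_pow]
  let χ : MulChar (ZMod l) R := MulChar.ofRootOfUnity humem hg
  have hχg : χ g = z ^ j := by rw [← hu]; exact MulChar.ofRootOfUnity_spec humem hg
  have hgen : ∀ x : ZMod l, x ≠ 0 → ∃ n : ℕ, x = (g : ZMod l) ^ n := by
    intro x hx
    obtain ⟨n, hn⟩ := (mem_powers_iff_mem_zpowers.2 (hg (Units.mk0 x hx)))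
    refine ⟨n, ?_⟩
    have := congrArg Units.val hn
    simpa using this.symm
  have hval : ∀ x, φ (χ x) = x ^ k := by
    intro x
    by_cases hx : x = 0
    · rw [hx, MulChar.map_zero, map_zero, zero_pow hk0]
    · obtain ⟨n, rfl⟩ := hgen x hx
      rw [map_pow, hχg, map_pow, map_pow, hjk, ← pow_mul, ← pow_mul, mul_comm]
  refine ⟨χ, k, hk.symm, hk0, hval, ?_, ?_, ?_⟩
  · ext x
    obtain ⟨n, hn⟩ := hgen x x.ne_zero
    rw [MulChar.one_apply_coe, MulChar.pow_apply_coe, hn, map_pow, hχg, ← pow_mul, ← pow_mul, ← mul_assoc, mul_comm (j * n),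
      pow_mul, hz.pow_eq_one, one_pow]
  · intro a ha
    have h1 : φ ((χ ^ a) g) = 1 := by rw [ha, MulChar.one_apply_coe, map_one]
    rw [MulChar.pow_apply_coe, map_pow, hval, ← pow_mul, ← Units.val_pow_eq_pow_val, Units.val_eq_one,
      ← orderOf_dvd_iff_pow_eq_one, hgl, hk, mul_comm] at h1
    exact Nat.dvd_of_mul_dvd_mul_left (Nat.pos_of_ne_zero hk0) (by simpa [mul_comm] using h1)
  · intro x hx
    obtain ⟨n, rfl⟩ := hgen x hx
    exact ⟨j * n, by rw [map_pow, hχg, ← pow_mul]⟩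

theorem aux_sum (l : ℕ) [Fact l.Prime] (m : ℕ) (h : 2 * m < l - 1) :
    ∑ x : ZMod l, x ^ m * (1 - x) ^ m = 0 := by
  let q : Polynomial (ZMod l) := Polynomial.X ^ m * (1 - Polynomial.X) ^ m
  have hq : q.natDegree < 2 * m + 1 := by
    have h1 : (1 - Polynomial.X : Polynomial (ZMod l)).natDegree ≤ 1 := by
      compute_degree
    have h2 : ((1 - Polynomial.X : Polynomial (ZMod l)) ^ m).natDegree ≤ m * 1 :=
      Polynomial.natDegree_pow_le_of_le m h1
    have h3 : q.natDegree ≤ m + m * 1 :=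
      Polynomial.natDegree_mul_le_of_le (Polynomial.natDegree_X_pow_le m) h2
    omega
  have h1 : ∀ x : ZMod l, x ^ m * (1 - x) ^ m = ∑ i ∈ range (2 * m + 1), q.coeff i * x ^ i := by
    intro x
    rw [← Polynomial.eval_eq_sum_range' hq]
    simp [q]
  simp_rw [h1]
  rw [Finset.sum_comm]
  refine Finset.sum_eq_zero fun i hi => ?_
  rw [← Finset.mul_sum, FiniteField.sum_pow_lt_card_sub_one, mul_zero]
  rw [ZMod.card]
  have := Finset.mem_range.1 hi
  omega

theorem aux_jac {K : Type*} [Field K] [NumberField K] (p : ℕ) (hp : p.Prime) (hp2 : p ≠ 2) (z : 𝓞 K)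
    (hz : IsPrimitiveRoot z p) (l : ℕ) [Fact l.Prime] (φ : 𝓞 K →+* ZMod l)
    (hφ : IsPrimitiveRoot (φ z) p) :
    ∃ A B : 𝓞 K, A * B = l ∧
      (∀ (f : 𝓞 K →+* 𝓞 K) (s : ℕ), 1 ≤ s → s ≤ p - 1 → f z = z ^ s →
        (Even s → φ (f A) = 0) ∧ (¬ Even s → φ (f B) = 0)) := by
  obtain ⟨χ, k, hk, hk0, hval, hχp, hχa, hχz⟩ := aux_char p hp z hz l φ hφ
  have hodd : Odd p := hp.odd_of_ne_two hp2
  obtain ⟨h, hh⟩ := hodd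
  have h0 : ∀ w : ℕ, 1 ≤ w → 2 * w < p → φ (jacobiSum (χ ^ w) (χ ^ w)) = 0 := by
    intro w hw hwp
    rw [jacobiSum, map_sum]
    have : ∀ x : ZMod l, φ ((χ ^ w) x * (χ ^ w) (1 - x)) = x ^ (k * w) * (1 - x) ^ (k * w) := by
      intro x
      rw [MulChar.pow_apply' _ (by omega), MulChar.pow_apply' _ (by omega), map_mul, map_pow, map_pow,
        hval, hval, pow_mul, pow_mul]
    simp_rw [this]
    apply aux_sum
    rw [← hk]
    have := Nat.mul_lt_mul_of_pos_right hwp (Nat.pos_of_ne_zero hk0)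
    calc 2 * (k * w) = 2 * w * k := by ring
      _ < p * k := this
  have hcomp : ∀ (f : 𝓞 K →+* 𝓞 K) (s a : ℕ), f z = z ^ s →
      f (jacobiSum (χ ^ a) (χ ^ a)) = jacobiSum (χ ^ (s * a)) (χ ^ (s * a)) := by
    intro f s a hf
    rw [← jacobiSum_ringHomComp]
    have : (χ ^ a).ringHomComp f = χ ^ (s * a) := by
      rw [← MulChar.ringHomComp_pow, pow_mul]
      congr 1
      ext x
      obtain ⟨j, hj⟩ := hχz x x.ne_zero
      rw [MulChar.ringHomComp_apply, MulChar.pow_apply_coe, hj, map_pow, hf, ← pow_mul, ← pow_mul,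
        mul_comm]
    rw [this]
  have hmod : ∀ a b : ℕ, χ ^ (p * a + b) = χ ^ b := by
    intro a b
    rw [pow_add, pow_mul, hχp, one_pow, one_mul]
  refine ⟨jacobiSum (χ ^ (h + 1)) (χ ^ (h + 1)), jacobiSum (χ ^ h) (χ ^ h), ?_, ?_⟩
  · apply NumberField.RingOfIntegers.coe_injective
    have hinj : Function.Injective (algebraMap (𝓞 K) K) := NumberField.RingOfIntegers.coe_injective
    rw [map_mul, map_natCast, ← jacobiSum_ringHomComp, ← jacobiSum_ringHomComp]
    have e1 : (χ ^ h).ringHomComp (algebraMap (𝓞 K) K) =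
        ((χ ^ (h + 1)).ringHomComp (algebraMap (𝓞 K) K))⁻¹ := by
      rw [eq_inv_iff_mul_eq_one, ← MulChar.ringHomComp_mul, ← pow_add,
        show h + (h + 1) = p by omega, hχp, MulChar.ringHomComp_one]
    have hne : ∀ a : ℕ, ¬ p ∣ a → (χ ^ a).ringHomComp (algebraMap (𝓞 K) K) ≠ 1 := by
      intro a ha h1
      exact ha (hχa a ((MulChar.ringHomComp_eq_one_iff hinj).1 h1))
    have hp3 : 3 ≤ p := by
      have := hp.two_le
      omega
    rw [e1, jacobiSum_mul_jacobiSum_inv, ZMod.card]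
    · rw [ringChar.eq_zero, ZMod.ringChar_zmod_n]
      exact (Fact.out : l.Prime).ne_zero.symm
    · exact hne _ (fun hd => by have := Nat.le_of_dvd (by omega) hd; omega)
    · exact hne _ (fun hd => by have := Nat.le_of_dvd (by omega) hd; omega)
    · rw [← MulChar.ringHomComp_mul, ← pow_add]
      refine hne _ (fun hd => ?_)
      rw [show h + 1 + (h + 1) = p + 1 by omega, Nat.dvd_add_right (dvd_refl p)] at hd
      have := Nat.le_of_dvd (by omega) hd
      omega
  · intro f s hs1 hs2 hf
    constructor
    · rintro ⟨w, hw⟩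
      rw [hcomp f s _ hf, show s * (h + 1) = p * w + w by rw [hw, hh]; ring, hmod]
      exact h0 w (by omega) (by omega)
    · intro hs
      obtain ⟨w, hw⟩ := Nat.not_even_iff_odd.1 hs
      rw [hcomp f s _ hf]
      obtain ⟨d, hd⟩ : ∃ d, h = w + d := ⟨h - w, by omega⟩
      have : s * h = p * w + d := by
        rw [hw, hh, hd]; ring
      rw [this, hmod]
      exact h0 d (by omega) (by omega)

theorem aux_absNorm {K : Type*} [Field K] [NumberField K] (l : ℕ) [Fact l.Prime]
    (ψ : 𝓞 K →+* ZMod l) : Ideal.absNorm (RingHom.ker ψ) = l := by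
  have hs : Function.Surjective ψ := ZMod.ringHom_surjective ψ
  rw [Ideal.absNorm_apply, Submodule.cardQuot_apply,
    Nat.card_congr (RingHom.quotientKerEquivOfSurjective hs).toEquiv, Nat.card_zmod]

theorem aux_prod {K : Type*} [Field K] [NumberField K] (l : ℕ) [Fact l.Prime]
    (ψ : ℕ → (𝓞 K →+* ZMod l)) (S : Finset ℕ) (hS : S.card = Module.finrank ℚ K)
    (hinj : ∀ i ∈ S, ∀ j ∈ S, RingHom.ker (ψ i) = RingHom.ker (ψ j) → i = j)
    (A B : 𝓞 K) (hAB : A * B = l) (E : ℕ → Prop) [DecidablePred E]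
    (hA : ∀ i ∈ S, E i → ψ i A = 0) (hB : ∀ i ∈ S, ¬ E i → ψ i B = 0) :
    ∏ i ∈ S.filter E, RingHom.ker (ψ i) = Ideal.span {A} := by
  have hl : l.Prime := Fact.out
  have hprime : ∀ i, Prime (RingHom.ker (ψ i)) := by
    intro i
    refine Ideal.prime_of_isPrime ?_ (RingHom.ker_isPrime _)
    intro h
    have := aux_absNorm l (ψ i)
    rw [h, Ideal.absNorm_bot] at this
    exact hl.ne_zero this.symm
  have hdvd : ∀ (E : ℕ → Prop) [DecidablePred E] (A : 𝓞 K), (∀ i ∈ S, E i → ψ i A = 0) →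
      ∏ i ∈ S.filter E, RingHom.ker (ψ i) ∣ Ideal.span {A} := by
    intro E _ A hA
    have hinj' : Set.InjOn (fun i => RingHom.ker (ψ i)) (S.filter E : Finset ℕ) := by
      intro i hi j hj hij
      simp only [coe_filter, Set.mem_ofPred_eq] at hi hj
      exact hinj i hi.1 j hj.1 hij
    classical
    rw [← Finset.prod_image (f := fun I => I) (g := fun i => RingHom.ker (ψ i)) hinj']
    apply Finset.prod_primes_dvd
    · intro I hI
      obtain ⟨i, -, rfl⟩ := Finset.mem_image.1 hI
      exact hprime i
    · intro I hI
      obtain ⟨i, hi, rfl⟩ := Finset.mem_image.1 hI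
      rw [Ideal.dvd_span_singleton, RingHom.mem_ker]
      exact hA i (Finset.mem_filter.1 hi).1 (Finset.mem_filter.1 hi).2
  obtain ⟨C, hC⟩ := hdvd E A hA
  obtain ⟨D, hD⟩ := hdvd (fun i => ¬ E i) B hB
  have hN : ∀ (E : ℕ → Prop) [DecidablePred E],
      Ideal.absNorm (∏ i ∈ S.filter E, RingHom.ker (ψ i)) = l ^ (S.filter E).card := by
    intro E _
    rw [map_prod, Finset.prod_congr rfl (fun i _ => aux_absNorm l (ψ i)), Finset.prod_const]
  have h1 : Ideal.absNorm (Ideal.span {A}) * Ideal.absNorm (Ideal.span {B}) = l ^ S.card := by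
    rw [← map_mul, Ideal.span_singleton_mul_span_singleton, hAB, hS, Ideal.absNorm_span_singleton,
      ← map_natCast (algebraMap ℤ (𝓞 K)), Algebra.norm_algebraMap, RingOfIntegers.rank]
    simp [Int.natAbs_pow]
  rw [hC, hD, map_mul, map_mul, hN, hN] at h1
  have h2 : Ideal.absNorm C * Ideal.absNorm D = 1 := by
    have h3 : (S.filter E).card + (S.filter (fun i => ¬ E i)).card = S.card :=
      Finset.card_filter_add_card_filter_not _
    rw [← h3, pow_add] at h1
    have h4 : l ^ (S.filter E).card * l ^ (S.filter (fun i => ¬ E i)).card ≠ 0 :=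
      mul_ne_zero (pow_ne_zero _ hl.ne_zero) (pow_ne_zero _ hl.ne_zero)
    apply mul_left_cancel₀ h4
    rw [mul_one]
    linear_combination h1
  have h5 : C = 1 := by
    rw [Ideal.one_eq_top]
    exact Ideal.absNorm_eq_one_iff.1 (Nat.eq_one_of_mul_eq_one_right h2)
  rw [hC, h5, mul_one]

theorem aux_ker {R : Type*} [CommRing R] (l : ℕ) (f g : R →+* ZMod l)
    (h : RingHom.ker f = RingHom.ker g) : f = g := by
  ext x
  obtain ⟨n, hn⟩ := ZMod.intCast_surjective (f x)
  have h1 : x - (n : R) ∈ RingHom.ker f := by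
    rw [RingHom.mem_ker, map_sub, map_intCast, hn, sub_self]
  rw [h, RingHom.mem_ker, map_sub, map_intCast, hn, sub_eq_zero] at h1
  exact h1.symm

theorem aux_principal (p : ℕ) (hp : p.Prime) (hp2 : p ≠ 2) {K : Type*} [Field K] [NumberField K]
    (hfr : Module.finrank ℚ K = p - 1) (z : 𝓞 K) (hz : IsPrimitiveRoot z p)
    (hadj : Algebra.adjoin ℤ {z} = ⊤)
    (τ : ℕ → (𝓞 K ≃+* 𝓞 K)) (s : ℕ → ℕ) (hs1 : ∀ i, 1 ≤ s i) (hs2 : ∀ i, s i ≤ p - 1)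
    (hsinj : ∀ i < p - 1, ∀ j < p - 1, s i = s j → i = j)
    (hτ : ∀ i, τ i (z ^ s i) = z)
    (P : Ideal (𝓞 K)) (hP : P.IsPrime) (l : ℕ) (hl : l.Prime) (hlP : (l : 𝓞 K) ∈ P)
    (hlp : ¬ l ∣ p) (t : ℤ) (ht : z - (t : 𝓞 K) ∈ P) :
    ∃ A : 𝓞 K, ∏ i ∈ (range (p - 1)).filter (fun i => Even (s i)), Ideal.map (τ i) P =
      Ideal.span {A} := by
  have : Fact l.Prime := ⟨hl⟩
  obtain ⟨φ, hφ⟩ := aux_hom z hadj P hP l hl hlP t ht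
  have hφp := aux_prim p hp z hz l hl hlp φ
  obtain ⟨A, B, hAB, hH⟩ := aux_jac p hp hp2 z hz l φ hφp
  have hτ' : ∀ i, (τ i).symm z = z ^ s i := by
    intro i
    rw [RingEquiv.symm_apply_eq, hτ]
  let ψ : ℕ → (𝓞 K →+* ZMod l) := fun i => φ.comp ((τ i).symm : 𝓞 K →+* 𝓞 K)
  have hker : ∀ i, Ideal.map (τ i) P = RingHom.ker (ψ i) := by
    intro i
    ext x
    rw [← Ideal.comap_symm, Ideal.mem_comap, ← hφ, RingHom.mem_ker, RingHom.mem_ker]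
    rfl
  refine ⟨A, ?_⟩
  simp_rw [hker]
  refine aux_prod l ψ (range (p - 1)) (by rw [card_range, hfr]) ?_ A B hAB _ ?_ ?_
  · intro i hi j hj hij
    have h1 := congrArg (fun f => f z) (aux_ker l _ _ hij)
    have h2 : ∀ i, ψ i z = (φ z) ^ s i := fun i => by
      rw [← map_pow, ← hτ' i]; rfl
    simp only [h2] at h1
    refine hsinj i (mem_range.1 hi) j (mem_range.1 hj) ?_
    have hp1 := hp.one_lt
    exact hφp.pow_inj (by have := hs2 i; omega) (by have := hs2 j; omega) h1
  · intro i _ hi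
    exact (hH ((τ i).symm : 𝓞 K →+* 𝓞 K) (s i) (hs1 i) (hs2 i) (hτ' i)).1 hi
  · intro i _ hi
    exact (hH ((τ i).symm : 𝓞 K →+* 𝓞 K) (s i) (hs1 i) (hs2 i) (hτ' i)).2 hi

theorem statement13
    (p : ℕ) (hp : p.Prime) (hp2 : p ≠ 2)
    (v : ℕ) (hv1 : 1 ≤ v) (hv2 : v ≤ p - 1)
    (hv : orderOf (v : ZMod p) = p - 1)
    (vn : ℤ → ℕ)
    (hvn1 : ∀ n : ℤ, 1 ≤ vn n) (hvn2 : ∀ n : ℤ, vn n ≤ p - 1)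
    (hvn0 : vn 0 = 1)
    (hvnrec : ∀ n : ℤ, (vn (n + 1) : ZMod p) = (v : ZMod p) * (vn n : ZMod p))
    (K : Type*) [Field K] [NumberField K]
    [IsCyclotomicExtension {p} ℚ K]
    (ζ : K) (hζ : IsPrimitiveRoot ζ p)
    (σ : K ≃ₐ[ℚ] K) (hσ : σ ζ = ζ ^ v)
    (σ' : 𝓞 K ≃+* 𝓞 K)
    (hσ' : ∀ x : 𝓞 K, algebraMap (𝓞 K) K (σ' x) = σ (algebraMap (𝓞 K) K x))
    (T : MulAut (ClassGroup (𝓞 K)))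
    (hT : ∀ I J : (Ideal (𝓞 K))⁰,
      Ideal.map σ' (I : Ideal (𝓞 K)) = (J : Ideal (𝓞 K)) →
      T (ClassGroup.mk0 I) = ClassGroup.mk0 J)
    :
    ∀ c : ClassGroup (𝓞 K), Nat.Coprime (orderOf c) p →
      ∏ i ∈ (Finset.range (p - 1)).filter (fun i : ℕ => Even (vn (-(i : ℤ)))),
        (T ^ i) c = 1 := by
  intro c _
  have hfp : Fact p.Prime := ⟨hp⟩
  have hnz : NeZero p := ⟨hp.ne_zero⟩
  have hp1 := hp.one_lt
  have hfr : Module.finrank ℚ K = p - 1 := by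
    rw [IsCyclotomicExtension.Rat.finrank p K, Nat.totient_prime hp]
  set z : 𝓞 K := hζ.toInteger with hzdef
  have hzζ : (z : K) = ζ := rfl
  have hz : IsPrimitiveRoot z p := hζ.toInteger_isPrimitiveRoot
  have hadj : Algebra.adjoin ℤ {z} = ⊤ := IsCyclotomicExtension.Rat.adjoin_singleton_eq_top hζ
  have hgenK : IntermediateField.adjoin ℚ {(z : K)} = ⊤ := by
    rw [hzζ]
    apply IntermediateField.toSubalgebra_injective
    rw [IntermediateField.adjoin_simple_toSubalgebra_of_isAlgebraic
      (Algebra.IsAlgebraic.isAlgebraic _), IntermediateField.top_toSubalgebra]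
    exact IsCyclotomicExtension.adjoin_primitive_root_eq_top hζ
  have hznb : (z : K) ∉ (⊥ : IntermediateField ℚ K) := by
    intro h
    have h3 := IntermediateField.adjoin_simple_le_iff.2 h
    rw [hgenK, top_le_iff] at h3
    have h4 := IntermediateField.bot_eq_top_iff_finrank_eq_one.1 h3
    omega
  have hσz : σ' z = z ^ v := by
    apply NumberField.RingOfIntegers.coe_injective
    rw [hσ', map_pow]
    exact hσ
  have hv0 : (v : ZMod p) ≠ 0 := by
    rw [Ne, ZMod.natCast_eq_zero_iff]
    intro h
    have := Nat.le_of_dvd (by omega) h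
    omega
  have hvi : ∀ i : ℕ, (v : ZMod p) ^ i * (vn (-(i : ℤ)) : ZMod p) = 1 := by
    intro i
    induction i with
    | zero => simp [hvn0]
    | succ i ih =>
      have h := hvnrec (-((i + 1 : ℕ) : ℤ))
      rw [show (-((i + 1 : ℕ) : ℤ)) + 1 = -(i : ℤ) by push_cast; ring] at h
      rw [h] at ih
      rw [← ih]; ring
  have hτz : ∀ i : ℕ, (σ' ^ i) z = z ^ (v ^ i) := by
    intro i
    induction i with
    | zero => simp
    | succ i ih =>
      rw [pow_succ', RingAut.mul_apply, ih, map_pow, hσz, ← pow_mul, pow_succ']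
  have hτ : ∀ i : ℕ, (σ' ^ i) (z ^ vn (-(i : ℤ))) = z := by
    intro i
    rw [map_pow, hτz, ← pow_mul]
    have h := hvi i
    have h1 : v ^ i * vn (-(i : ℤ)) ≡ 1 [MOD p] := by
      rw [← ZMod.natCast_eq_natCast_iff]; push_cast; exact h
    have h2 := (hz.isUnit_unit hp.ne_zero).eq_orderOf
    have h3 := pow_eq_pow_iff_modEq.2 (h2 ▸ h1)
    simpa using congrArg Units.val h3
  have hsinj : ∀ i < p - 1, ∀ j < p - 1, vn (-(i : ℤ)) = vn (-(j : ℤ)) → i = j := by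
    intro i hi j hj hij
    have h1 := hvi i
    have h2 := hvi j
    rw [hij] at h1
    have h3 : (v : ZMod p) ^ i = (v : ZMod p) ^ j :=
      mul_right_cancel₀ (right_ne_zero_of_mul_eq_one h1) (h1.trans h2.symm)
    exact pow_injOn_Iio_orderOf (by simpa [hv] using hi) (by simpa [hv] using hj) h3
  have hmap0 : ∀ (e : 𝓞 K ≃+* 𝓞 K) (I : Ideal (𝓞 K)), I ≠ 0 → Ideal.map e I ≠ 0 := by
    intro e I hI h
    exact hI ((Ideal.map_eq_bot_iff_of_injective e.injective).1 h)
  have hTi : ∀ (i : ℕ) (I : Ideal (𝓞 K)) (hI : I ∈ (Ideal (𝓞 K))⁰)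
      (hI' : Ideal.map (σ' ^ i) I ∈ (Ideal (𝓞 K))⁰),
      (T ^ i) (ClassGroup.mk0 ⟨I, hI⟩) = ClassGroup.mk0 ⟨Ideal.map (σ' ^ i) I, hI'⟩ := by
    intro i
    induction i with
    | zero =>
      intro I hI hI'
      simp only [pow_zero, MulAut.one_apply]
      congr 2
      exact (Ideal.map_id I).symm
    | succ i ih =>
      intro I hI hI'
      have hI'' : Ideal.map (σ' ^ i) I ∈ (Ideal (𝓞 K))⁰ :=
        mem_nonZeroDivisors_of_ne_zero (hmap0 _ _ (nonZeroDivisors.ne_zero hI))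
      rw [pow_succ', MulAut.mul_apply, ih I hI hI'']
      apply hT
      change Ideal.map σ' (Ideal.map (σ' ^ i) I) = Ideal.map (σ' ^ (i + 1)) I
      rw [pow_succ']
      exact Ideal.map_map (I := I) ((σ' ^ i : 𝓞 K ≃+* 𝓞 K) : 𝓞 K →+* 𝓞 K) (σ' : 𝓞 K →+* 𝓞 K)
  set S := (Finset.range (p - 1)).filter (fun i : ℕ => Even (vn (-(i : ℤ)))) with hS
  let Ψ : ClassGroup (𝓞 K) →* ClassGroup (𝓞 K) := ∏ i ∈ S, (T ^ i).toMonoidHom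
  have hΨ : ∀ c, Ψ c = ∏ i ∈ S, (T ^ i) c := by
    intro c
    simp only [Ψ, MonoidHom.finsetProd_apply]
    rfl
  rw [← hΨ]
  obtain ⟨X, rfl, hX⟩ := aux_deg1 z hgenK hznb p hp.ne_zero c
  rw [map_inv, inv_eq_one]
  obtain ⟨X, hXm⟩ := X
  have key : ∀ (X : Ideal (𝓞 K)) (hXm : X ∈ (Ideal (𝓞 K))⁰), (∀ P : Ideal (𝓞 K), P.IsPrime → X ≤ P →
        ∃ l : ℕ, l.Prime ∧ (l : 𝓞 K) ∈ P ∧ ¬ l ∣ p ∧ ∃ t : ℤ, z - (t : 𝓞 K) ∈ P) →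
        Ψ (ClassGroup.mk0 ⟨X, hXm⟩) = 1 := by
    clear hX
    intro X
    induction X using UniqueFactorizationMonoid.induction_on_prime with
    | h₁ => intro h; exact absurd rfl (nonZeroDivisors.ne_zero h)
    | h₂ I hI =>
      intro h _
      have hI1 : I = 1 := isUnit_iff_eq_one.1 hI
      subst hI1
      have : (⟨1, h⟩ : (Ideal (𝓞 K))⁰) = 1 := rfl
      rw [this, map_one, map_one]
    | h₃ I P hI hP ih =>
      intro h hgood
      have hIm : I ∈ (Ideal (𝓞 K))⁰ := mem_nonZeroDivisors_of_ne_zero hI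
      have hPm : P ∈ (Ideal (𝓞 K))⁰ := mem_nonZeroDivisors_of_ne_zero hP.ne_zero
      have e : (⟨P * I, h⟩ : (Ideal (𝓞 K))⁰) = ⟨P, hPm⟩ * ⟨I, hIm⟩ := rfl
      rw [e, map_mul, map_mul, ih hIm (fun Q hQ hIQ => hgood Q hQ (Ideal.mul_le_right.trans hIQ)), mul_one]
      have hPp : P.IsPrime := Ideal.isPrime_of_prime hP
      obtain ⟨l, hl, hlP, hlp, t, ht⟩ := hgood P hPp Ideal.mul_le_left
      obtain ⟨A, hA⟩ := aux_principal p hp hp2 hfr z hz hadj (fun i => σ' ^ i)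
        (fun i => vn (-(i : ℤ))) (fun i => hvn1 _) (fun i => hvn2 _) hsinj hτ P hPp l hl hlP hlp t ht
      rw [hΨ]
      have hm : ∀ i : ℕ, Ideal.map (σ' ^ i) P ∈ (Ideal (𝓞 K))⁰ := fun i =>
        mem_nonZeroDivisors_of_ne_zero (hmap0 _ _ hP.ne_zero)
      rw [Finset.prod_congr rfl (fun i _ => hTi i P hPm (hm i)), ← map_prod]
      have e2 : (∏ i ∈ S, (⟨Ideal.map (σ' ^ i) P, hm i⟩ : (Ideal (𝓞 K))⁰)) =
          ⟨Ideal.span {A}, by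
            rw [← hA]; exact Submonoid.prod_mem _ (fun i _ => hm i)⟩ := by
        apply Subtype.ext
        rw [Submonoid.coe_finsetProd]
        exact hA
      rw [e2, ClassGroup.mk0_eq_one_iff]
      exact ⟨⟨A, rfl⟩⟩
  exact key X hXm hX
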